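/- Let K, Θ ∈ ℝ^{n×n} be symmetric with K positive definite and Θ positive semidefinite. Then the 2n×2n block matrix A = [[0, Iₙ],[−K, −Θ]] is Hurwitz if and only if no nonzero eigenvector of K lies in the kernel of Θ, i.e., if and only if there is no nonzero v ∈ ℝⁿ and λ ∈ ℝ with Kv = λv and Θv = 0. -/

import Mathlib

open scoped Matrix

lemma re_mulVec_aux {n : ℕ} (K : Matrix (Fin n) (Fin n) ℝ) (x : Fin n → ℂ) (i : Fin n) :
    (((K.map Complex.ofReal) *ᵥ x) i).re = (K *ᵥ (fun j => (x j).re)) i := by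
  simp [Matrix.mulVec, dotProduct, Complex.re_sum]

lemma im_mulVec_aux {n : ℕ} (K : Matrix (Fin n) (Fin n) ℝ) (x : Fin n → ℂ) (i : Fin n) :
    (((K.map Complex.ofReal) *ᵥ x) i).im = (K *ᵥ (fun j => (x j).im)) i := by
  simp [Matrix.mulVec, dotProduct, Complex.im_sum]

lemma symm_dot_aux {n : ℕ} {K : Matrix (Fin n) (Fin n) ℝ} (hK : K.IsSymm) (a b : Fin n → ℝ) :
    b ⬝ᵥ K *ᵥ a = a ⬝ᵥ K *ᵥ b := by
  rw [Matrix.dotProduct_mulVec, ← Matrix.mulVec_transpose, hK.eq, dotProduct_comm]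

lemma ker_aux {n : ℕ} {Θ : Matrix (Fin n) (Fin n) ℝ} (hs : Θ.IsSymm)
    (hp : ∀ x : Fin n → ℝ, 0 ≤ x ⬝ᵥ Θ.mulVec x) (a : Fin n → ℝ) (ha : a ⬝ᵥ Θ *ᵥ a = 0) :
    Θ *ᵥ a = 0 := by
  have h : Θ.PosSemidef := by
    refine Matrix.PosSemidef.of_dotProduct_mulVec_nonneg ?_ ?_
    · rw [Matrix.IsHermitian, Matrix.conjTranspose_eq_transpose_of_trivial]; exact hs
    · intro x; simpa using hp x
  exact (h.dotProduct_mulVec_zero_iff a).1 (by simpa using ha)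

/-- For `K` symmetric positive definite and `Θ` symmetric positive semidefinite, the block
matrix `A = [[0, I],[−K, −Θ]]` is Hurwitz iff no nonzero eigenvector of `K` lies in the
kernel of `Θ`. -/
theorem damped_secondOrder_Hurwitz_iff
    (n : ℕ) (K Θ : Matrix (Fin n) (Fin n) ℝ)
    (hKsymm : K.IsSymm) (hΘsymm : Θ.IsSymm)
    (hKpd : ∀ x : Fin n → ℝ, x ≠ 0 → 0 < x ⬝ᵥ K.mulVec x)
    (hΘpsd : ∀ x : Fin n → ℝ, 0 ≤ x ⬝ᵥ Θ.mulVec x) :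
    letI A : Matrix (Fin n ⊕ Fin n) (Fin n ⊕ Fin n) ℂ :=
      Matrix.fromBlocks 0 1 (-(K.map (Complex.ofReal))) (-(Θ.map (Complex.ofReal)))
    ((∀ μ : ℂ, (∃ z : (Fin n ⊕ Fin n) → ℂ, z ≠ 0 ∧ A.mulVec z = μ • z) → μ.re < 0)
      ↔ ¬ ∃ v : Fin n → ℝ, v ≠ 0 ∧ ∃ lam : ℝ, K.mulVec v = lam • v ∧ Θ.mulVec v = 0) := by
  constructor
  · rintro h ⟨v, hv, lam, hK, hΘ⟩
    have hpos := hKpd v hv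
    have hvv : 0 ≤ v ⬝ᵥ v := Finset.sum_nonneg fun i _ => mul_self_nonneg (v i)
    rw [hK, dotProduct_smul, smul_eq_mul] at hpos
    have hlam : 0 < lam := by
      by_contra hc
      nlinarith [mul_nonneg (neg_nonneg.2 (not_lt.1 hc)) hvv]
    have hsq : ((Real.sqrt lam : ℝ) : ℂ) * (Real.sqrt lam : ℝ) = (lam : ℂ) := by
      rw [← Complex.ofReal_mul, Real.mul_self_sqrt hlam.le]
    set μ : ℂ := Complex.I * (Real.sqrt lam : ℝ) with hμ
    have hμ2 : μ * μ = -(lam : ℂ) := by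
      rw [hμ]; linear_combination Complex.I * Complex.I * hsq + (lam : ℂ) * Complex.I_mul_I
    have hKc : (K.map Complex.ofReal) *ᵥ (fun i => (v i : ℂ)) = fun i => (lam : ℂ) * v i := by
      ext i
      apply Complex.ext
      · rw [re_mulVec_aux]; simpa using congrFun hK i
      · rw [im_mulVec_aux]; simp [Matrix.mulVec, dotProduct]
    have hΘc : (Θ.map Complex.ofReal) *ᵥ (fun i => (v i : ℂ)) = 0 := by
      ext i
      apply Complex.ext
      · rw [re_mulVec_aux]; simpa using congrFun hΘ i
      · rw [im_mulVec_aux]; simp [Matrix.mulVec, dotProduct]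
    have := h μ ⟨Sum.elim (fun i => (v i : ℂ)) (μ • fun i => (v i : ℂ)), ?_, ?_⟩
    · simp [hμ] at this
    · intro h0
      apply hv
      ext i
      simpa using congrFun h0 (Sum.inl i)
    · rw [Matrix.fromBlocks_mulVec]
      simp only [Sum.elim_comp_inl, Sum.elim_comp_inr, Matrix.neg_mulVec, Matrix.mulVec_smul,
        hKc, hΘc, Matrix.zero_mulVec, Matrix.one_mulVec]
      ext (i | i)
      · simp
      · simp only [Sum.elim_inr, Pi.add_apply, Pi.neg_apply, Pi.smul_apply, smul_eq_mul, smul_zero,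
          Pi.zero_apply]
        linear_combination -(v i : ℂ) * hμ2
  · rintro hno μ ⟨z, hz, hA⟩
    by_contra hs
    rw [not_lt] at hs
    set x : Fin n → ℂ := z ∘ Sum.inl with hx
    set w : Fin n → ℂ := z ∘ Sum.inr with hw
    rw [Matrix.fromBlocks_mulVec] at hA
    have h1 : ∀ i, w i = μ * x i := by
      intro i
      simpa [hx, hw] using congrFun hA (Sum.inl i)
    have hwx : w = μ • x := by ext i; simpa using h1 i
    have h2 : ∀ i, ((K.map Complex.ofReal) *ᵥ x) i + μ * ((Θ.map Complex.ofReal) *ᵥ x) i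
        + μ * μ * x i = 0 := by
      intro i
      have := congrFun hA (Sum.inr i)
      simp only [Sum.elim_inr, ← hx, ← hw, hwx, Matrix.neg_mulVec, Matrix.mulVec_smul,
        Pi.add_apply, Pi.neg_apply, Pi.smul_apply, smul_eq_mul] at this
      have hzi : z (Sum.inr i) = μ * x i := h1 i
      rw [hzi] at this
      linear_combination -this
    set a : Fin n → ℝ := fun i => (x i).re with ha
    set b : Fin n → ℝ := fun i => (x i).im with hb
    obtain ⟨s, t⟩ := μ
    simp only at hs
    have hre : K *ᵥ a + s • Θ *ᵥ a - t • Θ *ᵥ b + (s * s - t * t) • a - (2 * s * t) • b = 0 := by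
      ext i
      have := congrArg Complex.re (h2 i)
      simp only [Complex.add_re, Complex.mul_re, Complex.mul_im, re_mulVec_aux, im_mulVec_aux,
        Complex.zero_re] at this
      simp only [Pi.add_apply, Pi.sub_apply, Pi.smul_apply, smul_eq_mul, Pi.zero_apply, ha, hb]
      linear_combination this
    have him : K *ᵥ b + s • Θ *ᵥ b + t • Θ *ᵥ a + (s * s - t * t) • b + (2 * s * t) • a = 0 := by
      ext i
      have := congrArg Complex.im (h2 i)
      simp only [Complex.add_im, Complex.mul_re, Complex.mul_im, re_mulVec_aux, im_mulVec_aux,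
        Complex.zero_im] at this
      simp only [Pi.add_apply, Pi.smul_apply, smul_eq_mul, Pi.zero_apply, ha, hb]
      linear_combination this
    have hab : a ≠ 0 ∨ b ≠ 0 := by
      by_contra hc
      push Not at hc
      have hx0 : ∀ i, x i = 0 := fun i =>
        Complex.ext (congrFun hc.1 i) (congrFun hc.2 i)
      apply hz
      ext (i | i)
      · exact hx0 i
      · have : w i = 0 := by rw [h1, hx0, mul_zero]
        exact this
    have e1 := congrArg (fun y => a ⬝ᵥ y) hre
    have e2 := congrArg (fun y => b ⬝ᵥ y) him
    have e3 := congrArg (fun y => a ⬝ᵥ y) him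
    have e4 := congrArg (fun y => b ⬝ᵥ y) hre
    simp only [dotProduct_add, dotProduct_sub, dotProduct_smul, smul_eq_mul, dotProduct_zero]
      at e1 e2 e3 e4
    rw [symm_dot_aux hΘsymm a b, dotProduct_comm b a] at e2
    rw [symm_dot_aux hΘsymm a b, symm_dot_aux hKsymm a b, dotProduct_comm b a] at e4
    have nn : ∀ y : Fin n → ℝ, 0 ≤ y ⬝ᵥ y := fun y =>
      Finset.sum_nonneg fun i _ => mul_self_nonneg (y i)
    have pp : ∀ y : Fin n → ℝ, y ≠ 0 → 0 < y ⬝ᵥ y := fun y hy =>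
      lt_of_le_of_ne (nn y) (fun h => hy (dotProduct_self_eq_zero.1 h.symm))
    have kn : ∀ y : Fin n → ℝ, 0 ≤ y ⬝ᵥ K *ᵥ y := fun y => by
      by_cases hy : y = 0
      · simp [hy]
      · exact (hKpd y hy).le
    have hm : 0 < a ⬝ᵥ a + b ⬝ᵥ b := by
      rcases hab with h | h
      · linarith [pp a h, nn b]
      · linarith [pp b h, nn a]
    have hk : 0 < a ⬝ᵥ K *ᵥ a + b ⬝ᵥ K *ᵥ b := by
      rcases hab with h | h
      · linarith [hKpd a h, kn b]
      · linarith [hKpd b h, kn a]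
    have hθa := hΘpsd a
    have hθb := hΘpsd b
    have E1 : (a ⬝ᵥ K *ᵥ a + b ⬝ᵥ K *ᵥ b) + s * (a ⬝ᵥ Θ *ᵥ a + b ⬝ᵥ Θ *ᵥ b)
        + (s * s - t * t) * (a ⬝ᵥ a + b ⬝ᵥ b) = 0 := by linear_combination e1 + e2
    have E2 : t * ((a ⬝ᵥ Θ *ᵥ a + b ⬝ᵥ Θ *ᵥ b) + 2 * s * (a ⬝ᵥ a + b ⬝ᵥ b)) = 0 := by
      linear_combination e3 - e4
    rcases mul_eq_zero.1 E2 with ht | h0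
    · subst ht
      have := mul_nonneg hs (add_nonneg hθa hθb)
      have := mul_nonneg (mul_self_nonneg s) hm.le
      linarith
    · have hsm := mul_nonneg hs hm.le
      have hs0 : s = 0 := by
        have : s * (a ⬝ᵥ a + b ⬝ᵥ b) = 0 := by linarith
        exact (mul_eq_zero.1 this).resolve_right hm.ne'
      have hΘa := ker_aux hΘsymm hΘpsd a (by linarith)
      have hΘb := ker_aux hΘsymm hΘpsd b (by linarith)
      rw [hΘa, hΘb, hs0] at hre him
      apply hno
      rcases hab with h | h
      · refine ⟨a, h, t * t, ?_, hΘa⟩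
        ext i
        have := congrFun hre i
        simp at this ⊢
        linarith
      · refine ⟨b, h, t * t, ?_, hΘb⟩
        ext i
        have := congrFun him i
        simp at this ⊢
        linarith
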